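/- arXiv:2605.05243 — 2 statements merged into one kernel-verified Lean document; each statement's English description precedes it below -/
import Mathlib

section
/- Let ℓ ≥ 2 be an integer and q > 2. Define Ψ(w) = ((1+ℓw)^q + 1 + ℓ w^q) / (2 + 2ℓw + ℓ(ℓ+1)w²)^{q/2} for w ∈ [0,1]. Then: (1) if q ≥ 3, Ψ is strictly increasing on [0,1]; (2) if 2 < q < 3, then Ψ(w) < max{Ψ(0), Ψ(1)} for all 0 < w < 1. -/
/-- The one-variable function `Ψ(w) = ((1+ℓw)^r + 1 + ℓ w^r) / (2 + 2ℓw + ℓ(ℓ+1)w²)^(r/2)`. -/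
noncomputable def Psi (ℓ : ℕ) (r : ℝ) (w : ℝ) : ℝ :=
  ((1 + (ℓ : ℝ) * w) ^ r + 1 + (ℓ : ℝ) * w ^ r) /
    (2 + 2 * (ℓ : ℝ) * w + (ℓ : ℝ) * ((ℓ : ℝ) + 1) * w ^ 2) ^ (r / 2)

/-- Up to a positive factor, the derivative of `Psi ℓ (s + 1)` at `w` (with `k = ℓ`). -/
noncomputable def psiSlope (k s w : ℝ) : ℝ :=
  (1 - w) * (1 + k * w) ^ s + (2 + k * w) * w ^ s - (1 + k * w + w)

theorem hasDerivAt_affine_mul_rpow (α β c k s w : ℝ) (h : 0 < c + k * w) :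
    HasDerivAt (fun x => (α + β * x) * (c + k * x) ^ s)
      (β * (c + k * w) ^ s + (α + β * w) * (s * k * (c + k * w) ^ (s - 1))) w := by
  have h₁ : HasDerivAt (fun x => α + β * x) β w := by
    simpa using ((hasDerivAt_id w).const_mul β).const_add α
  have h₂ : HasDerivAt (fun x => c + k * x) k w := by
    simpa using ((hasDerivAt_id w).const_mul k).const_add c
  have h₃ := h₁.mul (h₂.rpow_const (p := s) (Or.inl h.ne'))
  exact h₃.congr_deriv (by ring)

theorem hasDerivAt_psi (ℓ : ℕ) (q w : ℝ) (hw : 0 < w) :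
    HasDerivAt (Psi ℓ q)
      (q * ℓ * (2 + 2 * (ℓ : ℝ) * w + (ℓ : ℝ) * ((ℓ : ℝ) + 1) * w ^ 2) ^ (q / 2 - 1) /
        ((2 + 2 * (ℓ : ℝ) * w + (ℓ : ℝ) * ((ℓ : ℝ) + 1) * w ^ 2) ^ (q / 2)) ^ 2 *
        psiSlope ℓ (q - 1) w) w := by
  unfold Psi psiSlope
  set k : ℝ := (ℓ : ℝ)
  have hk : 0 ≤ k := Nat.cast_nonneg ℓ
  have ha : 0 < 1 + k * w := by positivity
  have hD : 0 < 2 + 2 * k * w + k * (k + 1) * w ^ 2 := by positivity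
  have h₁ : HasDerivAt (fun x => 1 + k * x) k w := by
    simpa using ((hasDerivAt_id w).const_mul k).const_add 1
  have h₂ : HasDerivAt (fun x => 2 + 2 * k * x + k * (k + 1) * x ^ 2)
      (2 * k + k * (k + 1) * (2 * w)) w := by
    have e₁ := ((hasDerivAt_id w).const_mul (2 * k)).const_add 2
    have e₂ := (hasDerivAt_pow 2 w).const_mul (k * (k + 1))
    exact (e₁.add e₂).congr_deriv (by simp)
  have hN := ((h₁.rpow_const (p := q) (Or.inl ha.ne')).add_const 1).add
    ((Real.hasDerivAt_rpow_const (p := q) (Or.inl hw.ne')).const_mul k)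
  have h := hN.div (h₂.rpow_const (p := q / 2) (Or.inl hD.ne'))
    (Real.rpow_pos_of_pos hD _).ne'
  refine h.congr_deriv ?_
  rw [div_mul_eq_mul_div]
  congr 1
  have e₁ : (1 + k * w) ^ q = (1 + k * w) ^ (q - 1) * (1 + k * w) := by
    rw [Real.rpow_sub_one ha.ne']; field_simp
  have e₂ : w ^ q = w ^ (q - 1) * w := by
    rw [Real.rpow_sub_one hw.ne']; field_simp
  have e₃ : (2 + 2 * k * w + k * (k + 1) * w ^ 2) ^ (q / 2) =
      (2 + 2 * k * w + k * (k + 1) * w ^ 2) ^ (q / 2 - 1) *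
        (2 + 2 * k * w + k * (k + 1) * w ^ 2) := by
    rw [Real.rpow_sub_one hD.ne']; field_simp
  simp only [Pi.add_apply]
  rw [e₁, e₂, e₃]
  ring

theorem continuousOn_psi (ℓ : ℕ) (q : ℝ) (hq : 0 < q) :
    ContinuousOn (Psi ℓ q) (Set.Icc 0 1) := by
  unfold Psi
  have hpos : ∀ x ∈ Set.Icc (0 : ℝ) 1,
      0 < 2 + 2 * (ℓ : ℝ) * x + (ℓ : ℝ) * ((ℓ : ℝ) + 1) * x ^ 2 := fun x hx => by
    have := hx.1
    positivity
  refine ContinuousOn.div ?_ ?_ fun x hx => (Real.rpow_pos_of_pos (hpos x hx) _).ne'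
  · refine ContinuousOn.add (ContinuousOn.add ?_ continuousOn_const)
      (continuousOn_const.mul ?_)
    · exact ContinuousOn.rpow_const (by fun_prop) fun _ _ => Or.inr hq.le
    · exact ContinuousOn.rpow_const (by fun_prop) fun _ _ => Or.inr hq.le
  · exact ContinuousOn.rpow_const (by fun_prop) fun x hx => Or.inl (hpos x hx).ne'

theorem psi_deriv_factor_pos (ℓ : ℕ) (hℓ : 0 < ℓ) (q w : ℝ) (hq : 0 < q) (hw : 0 < w) :
    0 < q * ℓ * (2 + 2 * (ℓ : ℝ) * w + (ℓ : ℝ) * ((ℓ : ℝ) + 1) * w ^ 2) ^ (q / 2 - 1) /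
        ((2 + 2 * (ℓ : ℝ) * w + (ℓ : ℝ) * ((ℓ : ℝ) + 1) * w ^ 2) ^ (q / 2)) ^ 2 := by
  have : (0 : ℝ) < ℓ := Nat.cast_pos.mpr hℓ
  positivity

theorem strictMonoOn_psi {ℓ : ℕ} (hℓ : 0 < ℓ) {q a b : ℝ} (hq : 0 < q) (ha : 0 ≤ a) (hb : b ≤ 1)
    (h : ∀ w ∈ Set.Ioo a b, 0 < psiSlope ℓ (q - 1) w) :
    StrictMonoOn (Psi ℓ q) (Set.Icc a b) := by
  refine strictMonoOn_of_deriv_pos (convex_Icc a b)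
    ((continuousOn_psi ℓ q hq).mono (Set.Icc_subset_Icc ha hb)) fun w hw => ?_
  rw [interior_Icc] at hw
  have hw₀ : 0 < w := ha.trans_lt hw.1
  rw [(hasDerivAt_psi ℓ q w hw₀).deriv]
  exact mul_pos (psi_deriv_factor_pos ℓ hℓ q w hq hw₀) (h w hw)

theorem strictAntiOn_psi {ℓ : ℕ} (hℓ : 0 < ℓ) {q a b : ℝ} (hq : 0 < q) (ha : 0 ≤ a) (hb : b ≤ 1)
    (h : ∀ w ∈ Set.Ioo a b, psiSlope ℓ (q - 1) w < 0) :
    StrictAntiOn (Psi ℓ q) (Set.Icc a b) := by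
  refine strictAntiOn_of_deriv_neg (convex_Icc a b)
    ((continuousOn_psi ℓ q hq).mono (Set.Icc_subset_Icc ha hb)) fun w hw => ?_
  rw [interior_Icc] at hw
  have hw₀ : 0 < w := ha.trans_lt hw.1
  rw [(hasDerivAt_psi ℓ q w hw₀).deriv]
  exact mul_neg_of_pos_of_neg (psi_deriv_factor_pos ℓ hℓ q w hq hw₀) (h w hw)

/-- A consequence of Bernoulli's inequality. -/
theorem mul_one_add_le_rpow {x s : ℝ} (hx : 0 < x) (hs : 2 ≤ s) :
    x * (1 + (s - 1) * (x - 1)) ≤ x ^ s := by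
  have h := one_add_mul_self_le_rpow_one_add (s := x - 1) (by linarith) (p := s - 1) (by linarith)
  rw [add_sub_cancel] at h
  calc x * (1 + (s - 1) * (x - 1)) ≤ x * x ^ (s - 1) := by gcongr
    _ = x ^ s := by rw [Real.rpow_sub_one hx.ne']; field_simp

theorem psiSlope_pos {k s w : ℝ} (hk : 2 ≤ k) (hs : 2 ≤ s) (hw : w ∈ Set.Ioo (0 : ℝ) 1) :
    0 < psiSlope k s w := by
  obtain ⟨hw₀, hw₁⟩ := hw
  have hkw : 0 < k * w := by positivity
  have h₁ := mul_le_mul_of_nonneg_left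
    (mul_one_add_le_rpow (x := 1 + k * w) (by positivity) hs) (sub_nonneg.mpr hw₁.le)
  have h₂ := mul_le_mul_of_nonneg_left
    (mul_one_add_le_rpow hw₀ hs) (by positivity : 0 ≤ 2 + k * w)
  have h₃ : 0 < (s - 1) * ((1 - w) * (w * ((1 + k * w) * (k - 1) - 1))) := by
    refine mul_pos (by linarith) (mul_pos (by linarith) (mul_pos hw₀ ?_))
    nlinarith
  unfold psiSlope
  linarith

theorem psiSlope_third_deriv_neg {k m w : ℝ} (hk : 2 ≤ k) (hm : 0 < m) (hm₁ : m < 1)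
    (hw : w ∈ Set.Ioo (0 : ℝ) 1) :
    (3 * k - m * k - 2 * (m / w)) * w ^ (-m) < 3 * k ^ 2 * (1 + k * w) ^ (-m) := by
  obtain ⟨hw₀, hw₁⟩ := hw
  have hk₀ : 0 < k := by linarith
  have ha : 0 < 1 + k * w := by positivity
  have hv : 0 < m / w := by positivity
  rcases le_or_gt (3 * k - m * k - 2 * (m / w)) 0 with h | h
  · exact (mul_nonpos_of_nonpos_of_nonneg h (by positivity)).trans_lt (by positivity)
  have b₁ : k ^ m ≤ 1 + m * (k - 1) := by
    have := rpow_one_add_le_one_add_mul_self (s := k - 1) (by linarith) hm.le hm₁.le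
    rwa [add_sub_cancel] at this
  have b₂ : (1 + 1 / (k * w)) ^ m ≤ 1 + m * (1 / (k * w)) :=
    rpow_one_add_le_one_add_mul_self
      (le_trans (by norm_num) (by positivity : (0 : ℝ) ≤ 1 / (k * w))) hm.le hm₁.le
  have e : (1 + k * w) ^ m = w ^ m * (k ^ m * (1 + 1 / (k * w)) ^ m) := by
    rw [← Real.mul_rpow hk₀.le (by positivity), ← Real.mul_rpow hw₀.le (by positivity)]
    congr 1
    field_simp
    ring
  have key : (3 * k - m * k - 2 * (m / w)) * (k ^ m * (1 + 1 / (k * w)) ^ m) < 3 * k ^ 2 := by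
    have hbound : k ^ m * (1 + 1 / (k * w)) ^ m ≤ min k (1 + m * (k - 1)) * (1 + m / w / k) := by
      have hkm : k ^ m ≤ min k (1 + m * (k - 1)) := le_min (b₁.trans (by nlinarith)) b₁
      have hb₂ : (1 + 1 / (k * w)) ^ m ≤ 1 + m / w / k := b₂.trans_eq (by field_simp)
      have : 0 ≤ k ^ m := by positivity
      exact mul_le_mul hkm hb₂ (by positivity) (this.trans hkm)
    refine (mul_le_mul_of_nonneg_left hbound h.le).trans_lt ?_
    generalize m / w = v at *
    rcases le_or_gt (1 / 2) m with hm₂ | hm₂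
    · calc (3 * k - m * k - 2 * v) * (min k (1 + m * (k - 1)) * (1 + v / k))
          ≤ (3 * k - m * k - 2 * v) * (k * (1 + v / k)) := by
            gcongr; exact min_le_left _ _
        _ = (3 * k - m * k - 2 * v) * (k + v) := by field_simp
        _ < 3 * k ^ 2 := by
            nlinarith [mul_pos hk₀ hv, mul_nonneg (sub_nonneg.mpr hm₂) (mul_pos hk₀ hv).le,
              mul_nonneg (sub_nonneg.mpr hm₂) (sq_nonneg k), sq_nonneg (k - v), sq_nonneg v,
              mul_pos hv hv, mul_pos hk₀ hk₀]
    · have h₁ : (3 * k - m * k - 2 * v) * (k + v) ≤ 25 / 8 * k ^ 2 := by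
        nlinarith [sq_nonneg (k - 4 * v), mul_pos hm (mul_pos hk₀ hv),
          mul_pos hm (mul_pos hk₀ hk₀)]
      have h₂ : 1 + m * (k - 1) ≤ (1 + k) / 2 := by nlinarith
      calc (3 * k - m * k - 2 * v) * (min k (1 + m * (k - 1)) * (1 + v / k))
          ≤ (3 * k - m * k - 2 * v) * ((1 + k) / 2 * (1 + v / k)) := by
            gcongr; exact (min_le_right _ _).trans h₂
        _ = (3 * k - m * k - 2 * v) * (k + v) * ((1 + k) / (2 * k)) := by field_simp
        _ ≤ 25 / 8 * k ^ 2 * ((1 + k) / (2 * k)) := by gcongr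
        _ = 25 / 16 * (k * (1 + k)) := by field_simp; norm_num
        _ < 3 * k ^ 2 := by nlinarith
  rw [Real.rpow_neg hw₀.le, Real.rpow_neg ha.le, ← div_eq_mul_inv, ← div_eq_mul_inv,
    div_lt_div_iff₀ (by positivity) (by positivity), e]
  calc _ = (3 * k - m * k - 2 * (m / w)) * (k ^ m * (1 + 1 / (k * w)) ^ m) * w ^ m := by ring
    _ < _ := by gcongr

/-- A function vanishing at the ends of an interval, with negative third derivative inside, can
change sign only from negative to positive. -/
theorem pos_of_third_deriv_neg {f f₁ f₂ f₃ : ℝ → ℝ} {a b x y : ℝ}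
    (hc : ContinuousOn f (Set.Icc a b)) (ha : f a = 0) (hb : f b = 0)
    (h₁ : ∀ w ∈ Set.Ioo a b, HasDerivAt f (f₁ w) w)
    (h₂ : ∀ w ∈ Set.Ioo a b, HasDerivAt f₁ (f₂ w) w)
    (h₃ : ∀ w ∈ Set.Ioo a b, HasDerivAt f₂ (f₃ w) w)
    (hneg : ∀ w ∈ Set.Ioo a b, f₃ w < 0)
    (hax : a < x) (hxy : x < y) (hyb : y < b) (hx : 0 ≤ f x) : 0 < f y := by
  by_contra! hy
  have mvt : ∀ g g' : ℝ → ℝ, (∀ w ∈ Set.Ioo a b, HasDerivAt g (g' w) w) → ∀ c d, a < c → c < d →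
      d < b → ∃ e ∈ Set.Ioo c d, g' e = (g d - g c) / (d - c) := fun g g' hg c d hac hcd hdb =>
    exists_hasDerivAt_eq_slope g g' hcd
      (fun w hw => (hg w ⟨hac.trans_le hw.1, hw.2.trans_lt hdb⟩).continuousAt.continuousWithinAt)
      (fun w hw => hg w ⟨hac.trans hw.1, hw.2.trans hdb⟩)
  obtain ⟨c₁, hc₁, e₁⟩ := exists_hasDerivAt_eq_slope f f₁ hax
    (hc.mono (Set.Icc_subset_Icc_right (by linarith)))
    (fun w hw => h₁ w ⟨hw.1, by linarith [hw.2]⟩)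
  obtain ⟨c₂, hc₂, e₂⟩ := mvt f f₁ h₁ x y hax hxy hyb
  obtain ⟨c₃, hc₃, e₃⟩ := exists_hasDerivAt_eq_slope f f₁ hyb
    (hc.mono (Set.Icc_subset_Icc_left (by linarith)))
    (fun w hw => h₁ w ⟨by linarith [hw.1], hw.2⟩)
  have p₁ : 0 ≤ f₁ c₁ := e₁ ▸ div_nonneg (by linarith) (by linarith)
  have p₂ : f₁ c₂ ≤ 0 := e₂ ▸ div_nonpos_of_nonpos_of_nonneg (by linarith) (by linarith)
  have p₃ : 0 ≤ f₁ c₃ := e₃ ▸ div_nonneg (by linarith) (by linarith)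
  have l₁₂ := hc₁.2.trans hc₂.1
  have l₂₃ := hc₂.2.trans hc₃.1
  obtain ⟨d₁, hd₁, e₄⟩ := mvt f₁ f₂ h₂ c₁ c₂ hc₁.1 l₁₂ (l₂₃.trans hc₃.2)
  obtain ⟨d₂, hd₂, e₅⟩ := mvt f₁ f₂ h₂ c₂ c₃ (hc₁.1.trans l₁₂) l₂₃ hc₃.2
  have p₄ : f₂ d₁ ≤ 0 := e₄ ▸ div_nonpos_of_nonpos_of_nonneg (by linarith) (by linarith)
  have p₅ : 0 ≤ f₂ d₂ := e₅ ▸ div_nonneg (by linarith) (by linarith)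
  have hd := hd₁.2.trans hd₂.1
  have had := hc₁.1.trans hd₁.1
  have hdb := hd₂.2.trans hc₃.2
  obtain ⟨e, he, e₆⟩ := mvt f₂ f₃ h₃ d₁ d₂ had hd hdb
  have p₆ : 0 ≤ f₃ e := e₆ ▸ div_nonneg (by linarith) (by linarith)
  exact p₆.not_gt (hneg e ⟨had.trans he.1, he.2.trans hdb⟩)

theorem psiSlope_pos_of_nonneg {k s x y : ℝ} (hk : 2 ≤ k) (hs₁ : 1 < s) (hs₂ : s < 2)
    (hx₀ : 0 < x) (hxy : x < y) (hy₁ : y < 1) (hx : 0 ≤ psiSlope k s x) :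
    0 < psiSlope k s y := by
  have hk₀ : 0 < k := by linarith
  have hA (α β t w : ℝ) (hw : w ∈ Set.Ioo (0 : ℝ) 1) :=
    hasDerivAt_affine_mul_rpow α β 1 k t w (by have := hw.1; positivity)
  have hB (α β t w : ℝ) (hw : w ∈ Set.Ioo (0 : ℝ) 1) :
      HasDerivAt (fun x => (α + β * x) * x ^ t)
        (β * w ^ t + (α + β * w) * (t * w ^ (t - 1))) w := by
    simpa using hasDerivAt_affine_mul_rpow α β 0 1 t w (by simpa using hw.1)
  refine pos_of_third_deriv_neg (f := psiSlope k s) (a := 0) (b := 1)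
    (f₁ := fun w => (-1 + 0 * w) * (1 + k * w) ^ s +
      (s * k + -(s * k) * w) * (1 + k * w) ^ (s - 1) + (k + 0 * w) * w ^ s +
      (2 * s + s * k * w) * w ^ (s - 1) - (k + 1))
    (f₂ := fun w => (-2 * s * k + 0 * w) * (1 + k * w) ^ (s - 1) +
      (s * (s - 1) * k ^ 2 + -(s * (s - 1) * k ^ 2) * w) * (1 + k * w) ^ (s - 1 - 1) +
      (2 * k * s + 0 * w) * w ^ (s - 1) +
      (2 * s * (s - 1) + s * (s - 1) * k * w) * w ^ (s - 1 - 1))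
    (f₃ := fun w => s * (s - 1) * (-3 * k ^ 2 * (1 + k * w) ^ (s - 1 - 1) +
      (1 - w) * (s - 2) * k ^ 3 * (1 + k * w) ^ (s - 1 - 1 - 1) +
      3 * k * w ^ (s - 1 - 1) + (2 + k * w) * (s - 2) * w ^ (s - 1 - 1 - 1)))
    ?_ ?_ ?_ ?_ ?_ ?_ ?_ hx₀ hxy hy₁ hx
  · unfold psiSlope
    have hs₀ : 0 ≤ s := by linarith
    exact (((by fun_prop : Continuous fun w : ℝ => 1 - w).mul
      ((by fun_prop : Continuous fun w : ℝ => 1 + k * w).rpow_const fun _ => Or.inr hs₀)).add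
      ((by fun_prop : Continuous fun w : ℝ => 2 + k * w).mul
      (continuous_id.rpow_const fun _ => Or.inr hs₀))).sub
      (by fun_prop : Continuous fun w : ℝ => 1 + k * w + w) |>.continuousOn
  · simp [psiSlope, Real.zero_rpow (by linarith : s ≠ 0)]
  · simp [psiSlope]; ring
  · intro w hw
    have hlin : HasDerivAt (fun x => 1 + k * x + x) (k + 1) w := by
      exact ((((hasDerivAt_id w).const_mul k).const_add 1).add (hasDerivAt_id w)).congr_deriv
        (by simp)
    have e : psiSlope k s = fun x =>
        (1 + -1 * x) * (1 + k * x) ^ s + (2 + k * x) * x ^ s - (1 + k * x + x) := by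
      ext x
      unfold psiSlope
      ring
    rw [e]
    exact (((hA 1 (-1) s w hw).add (hB 2 k s w hw)).sub hlin).congr_deriv (by ring)
  · intro w hw
    refine HasDerivAt.congr_deriv (((((hA (-1) 0 s w hw).add (hA (s * k) (-(s * k)) (s - 1) w hw)).add
      (hB k 0 s w hw)).add (hB (2 * s) (s * k) (s - 1) w hw)).sub_const (k + 1)) ?_
    ring
  · intro w hw
    refine HasDerivAt.congr_deriv ((((hA (-2 * s * k) 0 (s - 1) w hw).add
      (hA (s * (s - 1) * k ^ 2) (-(s * (s - 1) * k ^ 2)) (s - 1 - 1) w hw)).add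
      (hB (2 * k * s) 0 (s - 1) w hw)).add
      (hB (2 * s * (s - 1)) (s * (s - 1) * k) (s - 1 - 1) w hw)) ?_
    ring
  · intro w hw
    have h := psiSlope_third_deriv_neg hk (m := 2 - s) (by linarith) (by linarith) hw
    obtain ⟨hw₀, hw₁⟩ := hw
    have ha : 0 < 1 + k * w := by positivity
    have e : s - 1 - 1 = -(2 - s) := by ring
    refine mul_neg_of_pos_of_neg (mul_pos (by linarith) (by linarith)) ?_
    rw [e, Real.rpow_sub_one hw₀.ne']
    have h₁ : 0 ≤ (1 - w) * (2 - s) * k ^ 3 * (1 + k * w) ^ (-(2 - s) - 1) :=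
      mul_nonneg (mul_nonneg (mul_nonneg (by linarith) (by linarith)) (by positivity))
        (by positivity)
    have h₂ : 3 * k * w ^ (-(2 - s)) + (2 + k * w) * (s - 2) * (w ^ (-(2 - s)) / w) =
        (3 * k - (2 - s) * k - 2 * ((2 - s) / w)) * w ^ (-(2 - s)) := by
      field_simp
      ring
    linarith

/-- For `ℓ ≥ 2` and `q > 2`: (1) if `q ≥ 3`, then `Ψ` is strictly increasing on `[0,1]`;
(2) if `2 < q < 3`, then `Ψ(w) < max{Ψ(0), Ψ(1)}` for all `0 < w < 1`. -/
theorem psi_q_gt_two (ℓ : ℕ) (hℓ : 2 ≤ ℓ) (q : ℝ) (hq : 2 < q) :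
    (3 ≤ q → StrictMonoOn (Psi ℓ q) (Set.Icc 0 1)) ∧
    (q < 3 → ∀ w ∈ Set.Ioo (0 : ℝ) 1, Psi ℓ q w < max (Psi ℓ q 0) (Psi ℓ q 1)) := by
  have hℓ₀ : 0 < ℓ := by omega
  have hk : (2 : ℝ) ≤ ℓ := by exact_mod_cast hℓ
  have hq₀ : 0 < q := by linarith
  refine ⟨fun h => strictMonoOn_psi hℓ₀ hq₀ le_rfl le_rfl fun w hw =>
    psiSlope_pos hk (by linarith) hw, fun h w hw => ?_⟩
  rcases le_or_gt 0 (psiSlope ℓ (q - 1) w) with h₀ | h₀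
  · refine lt_max_of_lt_right (strictMonoOn_psi hℓ₀ hq₀ hw.1.le le_rfl (fun y hy => ?_)
      (Set.left_mem_Icc.mpr hw.2.le) (Set.right_mem_Icc.mpr hw.2.le) hw.2)
    exact psiSlope_pos_of_nonneg hk (by linarith) (by linarith) hw.1 hy.1 hy.2 h₀
  · refine lt_max_of_lt_left (strictAntiOn_psi hℓ₀ hq₀ le_rfl hw.2.le (fun x hx => ?_)
      (Set.left_mem_Icc.mpr hw.1.le) (Set.right_mem_Icc.mpr hw.1.le) hw.1)
    by_contra! hx₀
    exact h₀.not_gt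
      (psiSlope_pos_of_nonneg hk (by linarith) (by linarith) hx.1 hx.2 hw.2 hx₀)
end

section
/- Let ℓ ≥ 1 be an integer and fix 0 < w < 1. Define Δ_w(r) = (1−w)(1+ℓw)^{r−1} + (2+ℓw) w^{r−1} − (1 + (ℓ+1)w) for r > 0. Then r ↦ Δ_w(r) is strictly convex on (0,∞), Δ_w(1) = 2(1−w), and Δ_w(2) = 0. Consequently, for every 0 < r < 1, the function Ψ_r(w) = ((1+ℓw)^r + 1 + ℓ w^r) / (2 + 2ℓw + ℓ(ℓ+1)w²)^{r/2} is strictly increasing on [0,1]. -/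
/-- The function `Δ_w(r) = (1-w)(1+ℓw)^(r-1) + (2+ℓw) w^(r-1) - (1 + (ℓ+1)w)`. -/
noncomputable def Delta (ℓ : ℕ) (w : ℝ) (r : ℝ) : ℝ :=
  (1 - w) * (1 + (ℓ : ℝ) * w) ^ (r - 1) + (2 + (ℓ : ℝ) * w) * w ^ (r - 1) -
    (1 + ((ℓ : ℝ) + 1) * w)

theorem strictConvexOn_rpow_const_base {b : ℝ} (hb : 0 < b) (hb1 : b ≠ 1) :
    StrictConvexOn ℝ Set.univ fun x : ℝ => b ^ x := by
  refine ⟨convex_univ, fun x _ y _ hxy s t hs ht hst => ?_⟩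
  have hne : Real.log b * x ≠ Real.log b * y := fun h =>
    hxy (mul_left_cancel₀ (Real.log_ne_zero_of_pos_of_ne_one hb hb1) h)
  have h := strictConvexOn_exp.2 (Set.mem_univ _) (Set.mem_univ _) hne hs ht hst
  simp only [Real.rpow_def_of_pos hb, smul_eq_mul] at h ⊢
  convert h using 2
  ring

theorem strictConvexOn_Delta (ℓ : ℕ) {w : ℝ} (hw0 : 0 < w) (hw1 : w < 1) :
    StrictConvexOn ℝ Set.univ (Delta ℓ w) := by
  have ha : 0 < 1 + (ℓ : ℝ) * w := by positivity
  refine ⟨convex_univ, fun x _ y _ hxy s t hs ht hst => ?_⟩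
  have hne : x - 1 ≠ y - 1 := fun h => hxy (by linarith)
  have h₁ := (convexOn_rpow_left ha).2 (Set.mem_univ (x - 1)) (Set.mem_univ (y - 1))
    hs.le ht.le hst
  have h₂ := (strictConvexOn_rpow_const_base hw0 hw1.ne).2 (Set.mem_univ (x - 1))
    (Set.mem_univ (y - 1)) hne hs ht hst
  have harg : s * (x - 1) + t * (y - 1) = s * x + t * y - 1 := by linear_combination -hst
  simp only [smul_eq_mul, harg] at h₁ h₂
  have h₁' := mul_le_mul_of_nonneg_left h₁ (sub_nonneg.2 hw1.le)
  have h₂' := mul_lt_mul_of_pos_left h₂ (show 0 < 2 + (ℓ : ℝ) * w by positivity)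
  simp only [Delta, smul_eq_mul]
  have hc : s * (1 + ((ℓ : ℝ) + 1) * w) + t * (1 + ((ℓ : ℝ) + 1) * w)
      = 1 + ((ℓ : ℝ) + 1) * w := by rw [← add_mul, hst, one_mul]
  linarith

theorem Delta_one (ℓ : ℕ) (w : ℝ) : Delta ℓ w 1 = 2 * (1 - w) := by
  simp only [Delta, sub_self, Real.rpow_zero]
  ring

theorem Delta_two (ℓ : ℕ) (w : ℝ) : Delta ℓ w 2 = 0 := by
  have h : (2 : ℝ) - 1 = 1 := by norm_num
  simp only [Delta, h, Real.rpow_one]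
  ring

theorem Delta_pos (ℓ : ℕ) {w r : ℝ} (hw0 : 0 < w) (hw1 : w < 1) (hr : r < 1) :
    0 < Delta ℓ w r := by
  have h := (strictConvexOn_Delta ℓ hw0 hw1).slope_strict_mono_adjacent
    (Set.mem_univ r) (Set.mem_univ 2) hr one_lt_two
  rw [Delta_one, Delta_two, div_lt_div_iff₀ (by linarith) (by norm_num)] at h
  nlinarith [mul_pos (sub_pos.2 hw1) (sub_pos.2 hr)]

/-- The derivative of `Psi ℓ r` is a positive multiple of `Delta ℓ w r`. -/
theorem hasDerivAt_Psi (ℓ : ℕ) (r : ℝ) {w : ℝ} (hw0 : 0 < w) :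
    HasDerivAt (Psi ℓ r)
      (r * ℓ * (2 + 2 * (ℓ : ℝ) * w + (ℓ : ℝ) * ((ℓ : ℝ) + 1) * w ^ 2) ^ (r / 2 - 1) /
        ((2 + 2 * (ℓ : ℝ) * w + (ℓ : ℝ) * ((ℓ : ℝ) + 1) * w ^ 2) ^ (r / 2)) ^ 2 *
        Delta ℓ w r) w := by
  have ha : 0 < 1 + (ℓ : ℝ) * w := by positivity
  have hD : 0 < 2 + 2 * (ℓ : ℝ) * w + (ℓ : ℝ) * ((ℓ : ℝ) + 1) * w ^ 2 := by positivity
  have hlin : HasDerivAt (fun x : ℝ => 1 + (ℓ : ℝ) * x) ℓ w := by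
    simpa using ((hasDerivAt_id w).const_mul (ℓ : ℝ)).const_add 1
  have hquad : HasDerivAt
      (fun x : ℝ => 2 + 2 * (ℓ : ℝ) * x + (ℓ : ℝ) * ((ℓ : ℝ) + 1) * x ^ 2)
      (2 * ℓ + ℓ * ((ℓ : ℝ) + 1) * (2 * w)) w := by
    simpa using (((hasDerivAt_id w).const_mul (2 * (ℓ : ℝ))).const_add 2).fun_add
      ((hasDerivAt_pow 2 w).const_mul ((ℓ : ℝ) * ((ℓ : ℝ) + 1)))
  have hnum := ((hlin.rpow_const (p := r) (Or.inl ha.ne')).add_const 1).add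
    ((Real.hasDerivAt_rpow_const (p := r) (Or.inl hw0.ne')).const_mul (ℓ : ℝ))
  have hden := hquad.rpow_const (p := r / 2) (Or.inl hD.ne')
  refine (hnum.div hden (Real.rpow_pos_of_pos hD _).ne').congr_deriv ?_
  have hsplit : ∀ {x : ℝ} (_ : 0 < x) (p : ℝ), x ^ p = x ^ (p - 1) * x := fun hx p => by
    rw [← Real.rpow_add_one hx.ne', sub_add_cancel]
  rw [div_mul_eq_mul_div]
  congr 1
  simp only [Delta, Pi.add_apply]
  rw [hsplit ha r, hsplit hw0 r, hsplit hD (r / 2)]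
  ring

theorem strictMonoOn_Psi {ℓ : ℕ} (hℓ : 1 ≤ ℓ) {r : ℝ} (hr0 : 0 < r) (hr1 : r < 1) :
    StrictMonoOn (Psi ℓ r) (Set.Icc 0 1) := by
  refine strictMonoOn_of_deriv_pos (convex_Icc 0 1) ?_ fun w hw => ?_
  · unfold Psi
    refine ContinuousOn.div ?_ ?_ fun w hw => ?_
    · exact Continuous.continuousOn (by fun_prop (disch := exact hr0.le))
    · exact Continuous.continuousOn (by fun_prop (disch := positivity))
    · have := hw.1
      positivity
  · rw [interior_Icc] at hw
    obtain ⟨hw0, hw1⟩ := hw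
    rw [(hasDerivAt_Psi ℓ r hw0).deriv]
    have hΔ := Delta_pos ℓ hw0 hw1 hr1
    have hℓ' : (0 : ℝ) < ℓ := by exact_mod_cast hℓ
    positivity

/-- For `ℓ ≥ 1` and fixed `0 < w < 1`, the function `r ↦ Δ_w(r)` is strictly convex
on `(0,∞)`, `Δ_w(1) = 2(1-w)` and `Δ_w(2) = 0`; consequently, for every `0 < r < 1`
the function `Ψ_r` is strictly increasing on `[0,1]`. -/
theorem delta_convex_and_psi_increasing (ℓ : ℕ) (hℓ : 1 ≤ ℓ) (w : ℝ)
    (hw0 : 0 < w) (hw1 : w < 1) :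
    StrictConvexOn ℝ (Set.Ioi 0) (Delta ℓ w) ∧
    Delta ℓ w 1 = 2 * (1 - w) ∧
    Delta ℓ w 2 = 0 ∧
    ∀ r : ℝ, 0 < r → r < 1 → StrictMonoOn (Psi ℓ r) (Set.Icc 0 1) := by
  exact ⟨(strictConvexOn_Delta ℓ hw0 hw1).subset (Set.subset_univ _) (convex_Ioi 0),
    Delta_one ℓ w, Delta_two ℓ w, fun _ hr0 hr1 => strictMonoOn_Psi hℓ hr0 hr1⟩
end
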